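/- Let q be a prime power and ν = (ν1,…,ν_k) a partition with k ≥ 1 nonzero parts; set N = |ν| and ν̃ = (ν1,…,ν_{k−1}), N' = N − ν_k. Let Δ ∈ M_N(𝔽_q) be diagonalizable of type ν and Δ' ∈ M_{N'}(𝔽_q) be diagonalizable of type ν̃. Then for every partition μ of N: σ(μ,Δ) = Σ_ρ θ_{μ/ρ}(q) · (q−1)^{Σ_{j≥2}(μ_j−ρ_j)} · q^{Σ_{j≥2}(C(μ_j,2)−C(ρ_j,2))} · σ(ρ,Δ'), where the sum is over all partitions ρ of N' such that μ/ρ is a horizontal strip (ρ_i ≤ μ_i and μ_{i+1} ≤ ρ_i for all i), θ_{μ/ρ}(t) = ([|μ|−|ρ|]_t!/[μ1−ρ1]_t!) · ∏_{i≥1} [ρ_i − ρ_{i+1} choose μ_{i+1} − ρ_{i+1}]_t, and C(m,2) = m(m−1)/2. -/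

import Mathlib

open Matrix Module Polynomial

attribute [local instance] Classical.propDecidable

/-- `μ` is a partition: its parts are weakly decreasing. -/
def IsPtn (μ : ℕ →₀ ℕ) : Prop := ∀ i, μ (i + 1) ≤ μ i

/-- The size `|μ|` of a partition. -/
def ptnSize (μ : ℕ →₀ ℕ) : ℕ := μ.sum fun _ v => v

/-- `W + ΔW + ⋯ + Δ^{j-1}W`. -/
noncomputable def iterSpan {F : Type} [Field F] {n : ℕ} (Δ : Matrix (Fin n) (Fin n) F)
    (W : Submodule F (Fin n → F)) (j : ℕ) : Submodule F (Fin n → F) :=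
  ⨆ i ∈ Finset.range j, W.map (Δ ^ i).mulVecLin

/-- `W` has `Δ`-profile `μ`. -/
def HasProfile {F : Type} [Field F] {n : ℕ} (Δ : Matrix (Fin n) (Fin n) F)
    (μ : ℕ →₀ ℕ) (W : Submodule F (Fin n → F)) : Prop :=
  ∀ j : ℕ, Module.finrank F (iterSpan Δ W (j + 1)) = ∑ i ∈ Finset.range (j + 1), μ i

/-- `σ(μ, Δ)`: the number of subspaces with `Δ`-profile `μ`. -/
noncomputable def sigmaProf {F : Type} [Field F] {n : ℕ} (μ : ℕ →₀ ℕ)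
    (Δ : Matrix (Fin n) (Fin n) F) : ℕ :=
  Nat.card {W : Submodule F (Fin n → F) // HasProfile Δ μ W}

/-- `X_α(Δ)`: the number of flags of `Δ`-invariant subspaces with successive
quotient dimensions given by `α`. -/
noncomputable def Xflag {F : Type} [Field F] {n ℓ : ℕ} (Δ : Matrix (Fin n) (Fin n) F)
    (α : Fin ℓ → ℕ) : ℕ :=
  Nat.card {W : Fin (ℓ + 1) → Submodule F (Fin n → F) //
    Monotone W ∧ W 0 = ⊥ ∧ W (Fin.last ℓ) = ⊤ ∧
    (∀ i, (W i).map Δ.mulVecLin ≤ W i) ∧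
    ∀ i : Fin ℓ, Module.finrank F (W i.succ) = Module.finrank F (W i.castSucc) + α i}

/-- The Gaussian binomial coefficient as a polynomial in `t`. -/
noncomputable def qbp : ℕ → ℕ → Polynomial ℤ
  | _, 0 => 1
  | 0, _ + 1 => 0
  | a + 1, b + 1 => qbp a b + Polynomial.X ^ (b + 1) * qbp a (b + 1)

/-- The `q`-integer `[m]_t`. -/
def qNat (t : ℚ) (m : ℕ) : ℚ := ∑ i ∈ Finset.range m, t ^ i

/-- The `q`-factorial `[m]_t!`. -/
def qFact (t : ℚ) (m : ℕ) : ℚ := ∏ i ∈ Finset.range m, qNat t (i + 1)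


/-- `Δ` is diagonalizable of type `ν`: there are distinct eigenvalues, indexed by the
support of `ν`, whose eigenspaces have dimension given by the parts of `ν` and whose sum
is the whole space. -/
def DiagOfType {F : Type} [Field F] {n : ℕ} (Δ : Matrix (Fin n) (Fin n) F)
    (ν : ℕ →₀ ℕ) : Prop :=
  ∃ a : ℕ → F, Set.InjOn a ν.support ∧
    (⨆ i ∈ ν.support, Module.End.eigenspace Δ.mulVecLin (a i)) = ⊤ ∧
    ∀ i ∈ ν.support,
      Module.finrank F (Module.End.eigenspace Δ.mulVecLin (a i)) = ν i


lemma qbp_zero_right (a : ℕ) : qbp a 0 = 1 := by cases a <;> simp [qbp]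

lemma qbp_eq_zero {a b : ℕ} (h : a < b) : qbp a b = 0 := by
  induction a generalizing b with
  | zero => cases b <;> simp_all [qbp]
  | succ a ih =>
    cases b with
    | zero => omega
    | succ b => simp [qbp, ih (show a < b by omega), ih (show a < b + 1 by omega)]

set_option linter.unusedSectionVars false

lemma finite_hom {F V E : Type} [Field F] [AddCommGroup V] [Module F V] [Finite V] [AddCommGroup E]
    [Module F E] [Finite E] : Finite (V →ₗ[F] E) :=
  Finite.of_injective (fun f : V →ₗ[F] E => (f : V → E)) DFunLike.coe_injective

section Counting
variable {F E : Type} [Field F] [Fintype F] [AddCommGroup E] [Module F E] [Finite E]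

lemma finrank_sup_single (B : Submodule F E) (z : E) :
    finrank F (B ⊔ Submodule.span F {z} : Submodule F E) =
      if z ∈ B then finrank F B else finrank F B + 1 := by
  split_ifs with h
  · rw [sup_eq_left.2 (by simpa using h)]
  · have h1 := Submodule.finrank_sup_add_finrank_inf_eq B (Submodule.span F {z})
    have hz : z ≠ 0 := fun h0 => h (h0 ▸ B.zero_mem)
    have h2 : B ⊓ Submodule.span F {z} = ⊥ := by
      rw [← disjoint_iff]
      exact (Submodule.disjoint_span_singleton' hz).2 h
    rw [h2, finrank_bot, finrank_span_singleton hz] at h1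
    omega

lemma card_mem (B : Submodule F E) :
    Nat.card {z : E // z ∈ B} = Fintype.card F ^ finrank F B := by
  have := Module.natCard_eq_pow_finrank (K := F) (V := B)
  simpa using this

lemma card_not_mem (B : Submodule F E) :
    (Nat.card {z : E // z ∉ B} : ℚ) =
      (Fintype.card F : ℚ) ^ finrank F E - (Fintype.card F : ℚ) ^ finrank F B := by
  have := Module.natCard_eq_pow_finrank (K := F) (V := E)
  have h2 := card_mem B
  have h3 : Nat.card {z : E // z ∈ B} + Nat.card {z : E // z ∉ B} = Nat.card E := by
    rw [← Nat.card_sum]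
    exact Nat.card_congr (Equiv.sumCompl _)
  rw [this, h2, Nat.card_eq_fintype_card (α := F)] at h3
  have h4 : ((Fintype.card F : ℚ) ^ finrank F B + (Nat.card {z : E // z ∉ B} : ℚ))  = (Fintype.card F : ℚ) ^ finrank F E := by
    exact_mod_cast h3
  linarith

/-- number of tuples enlarging `A` to dimension `t` -/
noncomputable def cnt (A : Submodule F E) (f t : ℕ) : ℕ :=
  Nat.card {y : Fin f → E // finrank F (A ⊔ Submodule.span F (Set.range y) : Submodule F E) = t}

lemma cnt_zero (A : Submodule F E) (t : ℕ) : cnt A 0 t = if t = finrank F A then 1 else 0 := by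
  unfold cnt
  have : ∀ y : Fin 0 → E, finrank F (A ⊔ Submodule.span F (Set.range y) : Submodule F E) = finrank F A := by
    intro y
    rw [Set.range_eq_empty, Submodule.span_empty, sup_bot_eq]
  simp only [this]
  split_ifs with h
  · subst h; simp
  · have : IsEmpty {y : Fin 0 → E // finrank F A = t} := ⟨fun x => h x.2.symm⟩
    simp

lemma cnt_lt (A : Submodule F E) (f t : ℕ) (ht : t < finrank F A) : cnt A f t = 0 := by
  unfold cnt
  have : IsEmpty {y : Fin f → E // finrank F (A ⊔ Submodule.span F (Set.range y) : Submodule F E) = t} := by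
    refine ⟨fun x => ?_⟩
    have h1 := x.2
    have : finrank F A ≤ finrank F (A ⊔ Submodule.span F (Set.range x.1) : Submodule F E) :=
      Submodule.finrank_mono le_sup_left
    omega
  simp

lemma card_single (B : Submodule F E) (t : ℕ) :
    (Nat.card {z : E // finrank F (B ⊔ Submodule.span F {z} : Submodule F E) = t + 1} : ℚ) =
      (if finrank F B = t + 1 then (Fintype.card F : ℚ) ^ (t + 1) else 0) +
      (if finrank F B = t then
        ((Fintype.card F : ℚ) ^ finrank F E - (Fintype.card F : ℚ) ^ t) else 0) := by
  simp only [finrank_sup_single]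
  by_cases h1 : finrank F B = t + 1
  · have : ∀ z : E, ((if z ∈ B then finrank F B else finrank F B + 1) = t + 1) ↔ z ∈ B := by
      intro z; split_ifs with h <;> simp [h, h1]
    simp only [this]
    rw [card_mem]; simp [h1]
  · by_cases h2 : finrank F B = t
    · have : ∀ z : E, ((if z ∈ B then finrank F B else finrank F B + 1) = t + 1) ↔ z ∉ B := by
        intro z; split_ifs with h <;> simp [h, h2]
      simp only [this]
      rw [card_not_mem]; simp [h2]
    · have : IsEmpty {z : E // (if z ∈ B then finrank F B else finrank F B + 1) = t + 1} := by
        refine ⟨fun x => ?_⟩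
        have := x.2
        split_ifs at this <;> omega
      simp [h1, h2]

lemma cnt_succ (A : Submodule F E) (f t : ℕ) :
    (cnt A (f + 1) (t + 1) : ℚ) = (Fintype.card F : ℚ) ^ (t + 1) * cnt A f (t + 1) +
      ((Fintype.card F : ℚ) ^ finrank F E - (Fintype.card F : ℚ) ^ t) * cnt A f t := by
  have : Fintype E := Fintype.ofFinite E
  have key : cnt A (f + 1) (t + 1) = ∑ y : Fin f → E,
      Nat.card {z : E // finrank F ((A ⊔ Submodule.span F (Set.range y)) ⊔ Submodule.span F {z} : Submodule F E) = t + 1} := by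
    rw [← Nat.card_sigma]
    unfold cnt
    refine Nat.card_congr ?_
    refine Equiv.trans (Equiv.subtypeEquiv ((Fin.snocEquiv (fun _ : Fin (f+1) => E)).symm.trans (Equiv.prodComm _ _)) (q := fun p => finrank F ((A ⊔ Submodule.span F (Set.range p.1)) ⊔ Submodule.span F {p.2} : Submodule F E) = t + 1) ?_) ?_
    · intro y
      have : (A ⊔ Submodule.span F (Set.range y) : Submodule F E) =
         (A ⊔ Submodule.span F (Set.range (fun i => y (Fin.castSucc i)))) ⊔ Submodule.span F {y (Fin.last f)} := by
        rw [sup_assoc, ← Submodule.span_union]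
        congr 2
        ext x
        simp only [Set.mem_range, Set.mem_union, Set.mem_singleton_iff]
        constructor
        · rintro ⟨i, rfl⟩
          refine Fin.lastCases (Or.inr rfl) (fun i => Or.inl ⟨i, rfl⟩) i
        · rintro (⟨i, rfl⟩ | rfl)
          exacts [⟨_, rfl⟩, ⟨_, rfl⟩]
      rw [this]
      rfl
    · exact Equiv.subtypeProdEquivSigmaSubtype (fun (a : Fin f → E) (b : E) => finrank F ((A ⊔ Submodule.span F (Set.range a)) ⊔ Submodule.span F {b} : Submodule F E) = t + 1)
  rw [key]
  push_cast
  simp only [card_single]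
  rw [Finset.sum_add_distrib, ← Finset.sum_filter, ← Finset.sum_filter, Finset.sum_const, Finset.sum_const]
  unfold cnt
  simp only [Nat.card_eq_fintype_card, Fintype.card_subtype, nsmul_eq_mul]
  ring

lemma cnt_formula (A : Submodule F E) (f d : ℕ) :
    (cnt A f (finrank F A + d) : ℚ) = Polynomial.aeval (Fintype.card F : ℚ) (qbp f d) *
      (Fintype.card F : ℚ) ^ ((f - d) * finrank F A) *
      ∏ i ∈ Finset.range d, ((Fintype.card F : ℚ) ^ finrank F E - (Fintype.card F : ℚ) ^ (finrank F A + i)) := by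
  induction f generalizing d with
  | zero =>
    cases d with
    | zero => simp [cnt_zero, qbp]
    | succ d => simp [cnt_zero, qbp]
  | succ f ih =>
    cases d with
    | zero =>
      have h0 := ih 0
      simp only [qbp_zero_right, add_zero] at h0 ⊢
      rcases Nat.eq_zero_or_pos (finrank F A) with h | h
      · have : ∀ f, cnt A f 0 = Nat.card {y : Fin f → E // finrank F (A ⊔ Submodule.span F (Set.range y) : Submodule F E) = 0} := fun _ => rfl
        have hA : A = ⊥ := Submodule.finrank_eq_zero.1 h
        subst hA
        simp only [finrank_bot, cnt]
        have h2 : ∀ y : Fin (f+1) → E, finrank F (⊥ ⊔ Submodule.span F (Set.range y) : Submodule F E) = 0 ↔ y = 0 := by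
          intro y
          rw [bot_sup_eq, Submodule.finrank_eq_zero, Submodule.span_eq_bot]
          simp [funext_iff]
        simp [h2]
      · obtain ⟨a, ha⟩ := Nat.exists_eq_succ_of_ne_zero h.ne'
        have := cnt_succ A f a
        rw [cnt_lt A f a (by omega)] at this
        rw [ha] at h0 ⊢
        rw [Nat.succ_eq_add_one] at h0 ⊢
        rw [this, h0]
        simp
        ring
    | succ d =>
      have h1 := cnt_succ A f (finrank F A + d)
      have h2 := ih (d + 1)
      have h3 := ih d
      rw [← add_assoc] at h2 ⊢
      rw [h1, h2, h3, Finset.prod_range_succ]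
      simp only [qbp, map_add, map_mul, map_pow, Polynomial.aeval_X]
      rcases Nat.lt_or_ge f (d + 1) with h | h
      · rw [qbp_eq_zero h]
        simp
        ring
      · obtain ⟨c, rfl⟩ := Nat.exists_eq_add_of_le h
        have e1 : d + 1 + c - (d + 1) = c := by omega
        have e2 : d + 1 + c - d = c + 1 := by omega
        have e3 : d + 1 + c + 1 - (d + 1) = c + 1 := by omega
        rw [e1, e2, e3]
        ring

end Counting

/-- splitting a subtype of a product -/
def prodSigma {A B : Type} (P : A → Prop) (Q : A → B → Prop) :
    {p : A × B // P p.1 ∧ Q p.1 p.2} ≃ Σ a : {a // P a}, {b // Q a b} where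
  toFun p := ⟨⟨p.1.1, p.2.1⟩, ⟨p.1.2, p.2.2⟩⟩
  invFun s := ⟨(s.1.1, s.2.1), s.1.2, s.2.2⟩
  left_inv _ := rfl
  right_inv _ := rfl

lemma card_prodSigma {A B : Type} [Finite A] [Finite B] (P : A → Prop) (Q : A → B → Prop) (c : ℚ)
    (h : ∀ a, P a → (Nat.card {b // Q a b} : ℚ) = c) :
    (Nat.card {p : A × B // P p.1 ∧ Q p.1 p.2} : ℚ) = Nat.card {a // P a} * c := by
  have : Fintype {a // P a} := Fintype.ofFinite _
  rw [Nat.card_congr (prodSigma P Q), Nat.card_sigma]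
  push_cast
  rw [Finset.sum_congr rfl (fun a _ => h a.1 a.2)]
  simp

section Chain
variable {F E : Type} [Field F] [Fintype F] [AddCommGroup E] [Module F E] [Finite E]

lemma card_hom_rank {C : Type} [AddCommGroup C] [Module F C] [Finite C] (A : Submodule F E) (t : ℕ) :
    Nat.card {ψ : C →ₗ[F] E // finrank F (A ⊔ LinearMap.range ψ : Submodule F E) = t} =
      cnt A (finrank F C) t := by
  unfold cnt
  let b := Module.finBasis F C
  refine Nat.card_congr ((Equiv.subtypeEquiv (b.constr F).toEquiv ?_).symm)
  intro y
  have : LinearMap.range (b.constr F y) = Submodule.span F (Set.range y) := Module.Basis.constr_range b F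
  rw [LinearEquiv.coe_toEquiv, this]

lemma finrank_comap_subtype {X : Type} [AddCommGroup X] [Module F X] [Finite X]
    (Y G : Submodule F X) (h : G ≤ Y) : finrank F (G.comap Y.subtype) = finrank F G := by
  exact (Submodule.comapSubtypeEquivOfLe h).finrank_eq

lemma chain_count (K : Submodule F E) (d e : ℕ → ℕ) (he0 : e 0 = finrank F K)
    (he : ∀ i, e (i + 1) = e i + d i) (n : ℕ) :
    ∀ (X : Type) [AddCommGroup X] [Module F X] [Finite X] (G : ℕ → Submodule F X)
      (_ : Monotone G) (_ : G 0 = ⊥) (_ : G n = ⊤),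
    (Nat.card {φ : X →ₗ[F] E //
        ∀ i ≤ n, finrank F (K ⊔ (G i).map φ : Submodule F E) = e i} : ℚ) =
      ∏ i ∈ Finset.range n,
        (Polynomial.aeval (Fintype.card F : ℚ) (qbp (finrank F (G (i + 1)) - finrank F (G i)) (d i)) *
        (Fintype.card F : ℚ) ^ ((finrank F (G (i + 1)) - finrank F (G i) - d i) * e i) *
        ∏ l ∈ Finset.range (d i),
          ((Fintype.card F : ℚ) ^ finrank F E - (Fintype.card F : ℚ) ^ (e i + l))) := by
  induction n with
  | zero =>
    intro X _ _ _ G hG h0 hn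
    have hs : Subsingleton X := by
      rw [← Submodule.subsingleton_iff F]
      exact subsingleton_of_bot_eq_top (h0 ▸ hn)
    have : ∀ φ : X →ₗ[F] E, ∀ i ≤ 0, finrank F (K ⊔ (G i).map φ : Submodule F E) = e i := by
      intro φ i hi
      obtain rfl : i = 0 := by omega
      rw [h0, Submodule.map_bot, sup_bot_eq, he0]
    have : Unique {φ : X →ₗ[F] E // ∀ i ≤ 0, finrank F (K ⊔ (G i).map φ : Submodule F E) = e i} :=
      { default := ⟨0, this 0⟩
        uniq := fun a => Subtype.ext (LinearMap.ext fun x => by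
          rw [Subsingleton.elim x 0]; simp) }
    rw [Nat.card_unique]
    simp
  | succ n ih =>
    intro X _ _ _ G hG h0 hn
    obtain ⟨C, hC⟩ := Submodule.exists_isCompl (G n)
    have hfin1 := finite_hom (F := F) (V := G n) (E := E)
    have hfin2 := finite_hom (F := F) (V := C) (E := E)
    have ihY := ih (G n) (fun i => (G i).comap (G n).subtype)
      (fun i j hij => Submodule.comap_mono (hG hij)) (by rw [h0]; simp)
      (by simp)
    let eqv : ((G n →ₗ[F] E) × (C →ₗ[F] E)) ≃ (X →ₗ[F] E) :=
      ((LinearMap.coprodEquiv F).trans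
        (LinearEquiv.arrowCongr (Submodule.prodEquivOfIsCompl _ _ hC) (LinearEquiv.refl F E))).toEquiv
    have hY : ∀ p : (G n →ₗ[F] E) × (C →ₗ[F] E), ∀ x : G n, eqv p x = p.1 x := by
      intro p x
      simp [eqv, LinearEquiv.arrowCongr_apply]
    have hCC : ∀ p : (G n →ₗ[F] E) × (C →ₗ[F] E), ∀ x : C, eqv p x = p.2 x := by
      intro p x
      simp [eqv, LinearEquiv.arrowCongr_apply]
    have hmap : ∀ p : (G n →ₗ[F] E) × (C →ₗ[F] E), ∀ i ≤ n,
        (G i).map (eqv p) = ((G i).comap (G n).subtype).map p.1 := by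
      intro p i hi
      ext y
      simp only [Submodule.mem_map, Submodule.mem_comap]
      constructor
      · rintro ⟨x, hx, rfl⟩
        exact ⟨⟨x, hG hi hx⟩, hx, (hY p ⟨x, hG hi hx⟩).symm⟩
      · rintro ⟨x, hx, rfl⟩
        exact ⟨x, hx, hY p x⟩
    have hmap2 : ∀ p : (G n →ₗ[F] E) × (C →ₗ[F] E),
        (G (n + 1)).map (eqv p) = LinearMap.range p.1 ⊔ LinearMap.range p.2 := by
      intro p
      rw [hn, ← hC.sup_eq_top, Submodule.map_sup, hmap p n le_rfl]
      congr 1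
      · simp
      · ext y
        simp only [Submodule.mem_map, LinearMap.mem_range]
        constructor
        · rintro ⟨x, hx, rfl⟩
          exact ⟨⟨x, hx⟩, (hCC p ⟨x, hx⟩).symm⟩
        · rintro ⟨x, rfl⟩
          exact ⟨x, x.2, hCC p x⟩
    have hcard : (Nat.card {φ : X →ₗ[F] E //
        ∀ i ≤ n + 1, finrank F (K ⊔ (G i).map φ : Submodule F E) = e i}) =
        Nat.card {p : (G n →ₗ[F] E) × (C →ₗ[F] E) //
          (∀ i ≤ n, finrank F (K ⊔ ((G i).comap (G n).subtype).map p.1 : Submodule F E) = e i) ∧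
          finrank F ((K ⊔ LinearMap.range p.1) ⊔ LinearMap.range p.2 : Submodule F E) = e (n + 1)} := by
      refine Nat.card_congr (Equiv.subtypeEquiv eqv ?_).symm
      intro p
      constructor
      · rintro ⟨h1, h2⟩ i hi
        rcases Nat.lt_or_ge n i with h | h
        · obtain rfl : i = n + 1 := by omega
          rw [hmap2, ← sup_assoc, h2]
        · rw [hmap p i h, h1 i h]
      · intro h
        refine ⟨fun i hi => ?_, ?_⟩
        · rw [← hmap p i hi, h i (by omega)]
        · rw [← h (n + 1) le_rfl, hmap2, ← sup_assoc]
    have hfC : finrank F C = finrank F (G (n + 1)) - finrank F (G n) := by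
      have := Submodule.finrank_add_eq_of_isCompl hC
      rw [hn, finrank_top]
      omega
    rw [hcard, card_prodSigma
      (fun a : G n →ₗ[F] E => ∀ i ≤ n, finrank F (K ⊔ ((G i).comap (G n).subtype).map a : Submodule F E) = e i)
      (fun (a : G n →ₗ[F] E) (b : C →ₗ[F] E) => finrank F ((K ⊔ LinearMap.range a) ⊔ LinearMap.range b : Submodule F E) = e (n + 1))
      (Polynomial.aeval (Fintype.card F : ℚ) (qbp (finrank F (G (n + 1)) - finrank F (G n)) (d n)) *
        (Fintype.card F : ℚ) ^ ((finrank F (G (n + 1)) - finrank F (G n) - d n) * e n) *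
        ∏ l ∈ Finset.range (d n),
          ((Fintype.card F : ℚ) ^ finrank F E - (Fintype.card F : ℚ) ^ (e n + l))), ihY,
      Finset.prod_range_succ]
    · congr 1
      refine Finset.prod_congr rfl fun i hi => ?_
      have hi' := Finset.mem_range.1 hi
      rw [finrank_comap_subtype _ _ (hG (show i ≤ n by omega)),
        finrank_comap_subtype _ _ (hG (show i + 1 ≤ n by omega))]
    · intro a ha
      have h1 := ha n le_rfl
      have h2 : ((G n).comap (G n).subtype).map a = LinearMap.range a := by simp
      rw [h2] at h1
      rw [card_hom_rank, he n, ← h1, cnt_formula, hfC]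

lemma card_subspaces (d : ℕ) (hd : d ≤ finrank F E) :
    (Nat.card {K : Submodule F E // finrank F K = d} : ℚ) *
      ∏ i ∈ Finset.range d, ((Fintype.card F : ℚ) ^ d - (Fintype.card F : ℚ) ^ i) =
      ∏ i ∈ Finset.range d, ((Fintype.card F : ℚ) ^ finrank F E - (Fintype.card F : ℚ) ^ i) := by
  have hpos : 1 ≤ Fintype.card F := Fintype.card_pos
  have h1 := card_linearIndependent (K := F) (V := E) hd
  have cast : ∀ m : ℕ, d ≤ m → ((∏ i : Fin d, (Fintype.card F ^ m - Fintype.card F ^ i.val) : ℕ) : ℚ) =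
      ∏ i ∈ Finset.range d, ((Fintype.card F : ℚ) ^ m - (Fintype.card F : ℚ) ^ i) := by
    intro m hm
    rw [Finset.prod_range, Nat.cast_prod]
    refine Finset.prod_congr rfl fun i _ => ?_
    rw [Nat.cast_sub (Nat.pow_le_pow_right hpos (by omega))]
    push_cast; rfl
  have e1 : {s : Fin d → E // LinearIndependent F s} ≃
      Σ K : {K : Submodule F E // finrank F K = d}, {s : Fin d → K.1 // LinearIndependent F s} :=
    { toFun := fun s => ⟨⟨Submodule.span F (Set.range s.1), by
          rw [finrank_span_eq_card s.2]; simp⟩,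
          ⟨fun i => ⟨s.1 i, Submodule.subset_span ⟨i, rfl⟩⟩, by
            rw [← LinearMap.linearIndependent_iff (Submodule.subtype _) (by simp)]
            exact s.2⟩⟩
      invFun := fun p => ⟨fun i => (p.2.1 i : E), by
        have := p.2.2
        rw [← LinearMap.linearIndependent_iff (Submodule.subtype _) (by simp)] at this
        exact this⟩
      left_inv := fun s => rfl
      right_inv := by
        rintro ⟨⟨K, hK⟩, s, hs⟩
        obtain ⟨⟨t, ht⟩, rfl⟩ : ∃ t : {t : Fin d → E // ∀ i, t i ∈ K}, s = fun i => ⟨t.1 i, t.2 i⟩ :=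
          ⟨⟨fun i => s i, fun i => (s i).2⟩, rfl⟩
        have : Submodule.span F (Set.range t) = K := by
          have h2 := hs
          rw [← LinearMap.linearIndependent_iff K.subtype (by simp)] at h2
          apply Submodule.eq_of_le_of_finrank_eq
          · rw [Submodule.span_le]; rintro _ ⟨i, rfl⟩; exact ht i
          · rw [hK]
            have := finrank_span_eq_card h2
            rw [Fintype.card_fin] at this
            exact this
        subst this
        rfl }
  have : Fintype {K : Submodule F E // finrank F K = d} := Fintype.ofFinite _
  rw [Nat.card_congr e1, Nat.card_sigma] at h1
  have h2 : ∀ K : {K : Submodule F E // finrank F K = d},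
      Nat.card {s : Fin d → K.1 // LinearIndependent F s} =
        ∏ i : Fin d, (Fintype.card F ^ d - Fintype.card F ^ i.val) := by
    intro K
    have := card_linearIndependent (K := F) (V := K.1) (k := d) K.2.ge
    rw [this, K.2]
  rw [Finset.sum_congr rfl (fun K _ => h2 K), Finset.sum_const, smul_eq_mul] at h1
  rw [← cast _ hd, ← cast d le_rfl, ← h1]
  simp
end Chain

section Krylov
variable {F : Type} [Field F]
variable {V V₂ : Type} [AddCommGroup V] [Module F V] [AddCommGroup V₂] [Module F V₂]

/-- `W + TW + ⋯ + T^{j-1}W`, recursively. -/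
def kry (T : V →ₗ[F] V) (W : Submodule F V) : ℕ → Submodule F V
  | 0 => ⊥
  | j + 1 => W ⊔ (kry T W j).map T

lemma kry_le_succ (T : V →ₗ[F] V) (W : Submodule F V) (j : ℕ) : kry T W j ≤ kry T W (j + 1) := by
  induction j with
  | zero => simp [kry]
  | succ j ih => exact sup_le_sup_left (Submodule.map_mono ih) W

lemma kry_mono (T : V →ₗ[F] V) (W : Submodule F V) : Monotone (kry T W) :=
  monotone_nat_of_le_succ (kry_le_succ T W)

lemma kry_shift_le (T : V →ₗ[F] V) (c : F) (W : Submodule F V) (j : ℕ) :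
    kry (T + c • LinearMap.id) W j ≤ kry T W j := by
  induction j with
  | zero => simp [kry]
  | succ j ih =>
    refine sup_le le_sup_left ?_
    rintro _ ⟨x, hx, rfl⟩
    have hx' := ih hx
    simp only [LinearMap.add_apply, LinearMap.smul_apply, LinearMap.id_apply]
    exact Submodule.add_mem _ (Submodule.mem_sup_right ⟨x, hx', rfl⟩)
      (Submodule.smul_mem _ _ (kry_le_succ T W j hx'))

lemma kry_shift (T : V →ₗ[F] V) (c : F) (W : Submodule F V) (j : ℕ) :
    kry (T + c • LinearMap.id) W j = kry T W j := by
  refine le_antisymm (kry_shift_le T c W j) ?_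
  have := kry_shift_le (T + c • LinearMap.id) (-c) W j
  simpa using this

lemma kry_map (T : V →ₗ[F] V) (T₂ : V₂ →ₗ[F] V₂) (g : V →ₗ[F] V₂) (h : ∀ x, g (T x) = T₂ (g x))
    (W : Submodule F V) (j : ℕ) : (kry T W j).map g = kry T₂ (W.map g) j := by
  induction j with
  | zero => simp [kry]
  | succ j ih =>
    simp only [kry]
    rw [Submodule.map_sup, ← ih, ← Submodule.map_comp, ← Submodule.map_comp]
    congr 2
    ext x
    exact h x

/-- profile for endomorphisms -/
def Prof (T : V →ₗ[F] V) (μ : ℕ →₀ ℕ) (W : Submodule F V) : Prop :=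
  ∀ j : ℕ, finrank F (kry T W j) = ∑ i ∈ Finset.range j, μ i

/-- number of subspaces with given profile -/
noncomputable def sig (μ : ℕ →₀ ℕ) (T : V →ₗ[F] V) : ℕ :=
  Nat.card {W : Submodule F V // Prof T μ W}

lemma sig_shift (μ : ℕ →₀ ℕ) (T : V →ₗ[F] V) (c : F) : sig μ (T + c • LinearMap.id) = sig μ T := by
  unfold sig
  refine Nat.card_congr (Equiv.subtypeEquivRight fun W => ?_)
  unfold Prof
  refine forall_congr' fun j => ?_
  rw [kry_shift]

lemma sig_conj (μ : ℕ →₀ ℕ) (T : V →ₗ[F] V) (T₂ : V₂ →ₗ[F] V₂) (g : V ≃ₗ[F] V₂)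
    (h : ∀ x, g (T x) = T₂ (g x)) : sig μ T = sig μ T₂ := by
  unfold sig
  refine Nat.card_congr (Equiv.subtypeEquiv (Submodule.orderIsoMapComap g).toEquiv ?_)
  intro W
  have : ∀ j, finrank F (kry T₂ (W.map (g : V →ₗ[F] V₂)) j) = finrank F (kry T W j) := by
    intro j
    rw [← kry_map T T₂ (g : V →ₗ[F] V₂) h W j]
    exact LinearEquiv.finrank_map_eq g _
  unfold Prof
  simp only [← this]
  rfl

lemma iterSpan_eq {n : ℕ} (Δ : Matrix (Fin n) (Fin n) F) (W : Submodule F (Fin n → F)) (j : ℕ) :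
    iterSpan Δ W j = kry Δ.mulVecLin W j := by
  induction j with
  | zero => simp [iterSpan, kry]
  | succ j ih =>
    rw [kry, ← ih]
    have hs : ∀ i, W.map (Δ ^ (i + 1)).mulVecLin = (W.map (Δ ^ i).mulVecLin).map Δ.mulVecLin := by
      intro i
      rw [pow_succ', Matrix.mulVecLin_mul, Submodule.map_comp]
    have h0 : W.map (Δ ^ 0).mulVecLin = W := by
      rw [pow_zero, Matrix.mulVecLin_one, Submodule.map_id]
    unfold iterSpan
    apply le_antisymm
    · refine iSup₂_le fun i hi => ?_
      cases i with
      | zero => rw [h0]; exact le_sup_left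
      | succ i =>
        rw [hs]
        refine le_trans (Submodule.map_mono ?_) le_sup_right
        exact le_iSup₂_of_le i (by simp at hi ⊢; omega) le_rfl
    · refine sup_le ?_ ?_
      · exact le_iSup₂_of_le 0 (by simp) h0.ge
      · simp only [Submodule.map_iSup]
        refine iSup₂_le fun i hi => ?_
        rw [← hs]
        exact le_iSup₂_of_le (i + 1) (by simp at hi ⊢; omega) le_rfl

lemma sigmaProf_eq {n : ℕ} (μ : ℕ →₀ ℕ) (Δ : Matrix (Fin n) (Fin n) F) :
    sigmaProf μ Δ = sig μ Δ.mulVecLin := by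
  unfold sigmaProf sig HasProfile Prof
  refine Nat.card_congr (Equiv.subtypeEquivRight fun W => ⟨fun h j => ?_, fun h j => ?_⟩)
  · cases j with
    | zero => rw [kry, finrank_bot]; simp
    | succ j => rw [← iterSpan_eq]; exact h j
  · rw [iterSpan_eq]; exact h (j + 1)
end Krylov

section Fiber
variable {F V E : Type} [Field F] [Fintype F] [AddCommGroup V] [Module F V] [Finite V]
  [AddCommGroup E] [Module F E] [Finite E]

lemma finrank_prod_sub (Z : Submodule F (V × E)) :
    finrank F Z = finrank F (Z.map (LinearMap.fst F V E)) + finrank F (Z.comap (LinearMap.inr F V E)) := by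
  have h := LinearMap.finrank_range_add_finrank_ker ((LinearMap.fst F V E).domRestrict Z)
  rw [LinearMap.range_domRestrict, LinearMap.ker_domRestrict] at h
  rw [← h]
  congr 1
  rw [← Submodule.finrank_map_subtype_eq, Submodule.map_comap_subtype]
  rw [(Submodule.equivMapOfInjective (LinearMap.inr F V E) LinearMap.inr_injective _).finrank_eq,
    Submodule.map_comap_eq, LinearMap.range_inr, inf_comm]

/-- the nilpotent-free part: `D ⊕ 0` -/
def extT (D : V →ₗ[F] V) : (V × E) →ₗ[F] (V × E) :=
  LinearMap.inl F V E ∘ₗ D ∘ₗ LinearMap.fst F V E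

lemma kry_fst (D : V →ₗ[F] V) (W : Submodule F (V × E)) (j : ℕ) :
    (kry (extT D) W j).map (LinearMap.fst F V E) = kry D (W.map (LinearMap.fst F V E)) j :=
  kry_map _ _ _ (fun x => by simp [extT]) W j

lemma kry_ext (D : V →ₗ[F] V) (W : Submodule F (V × E)) (j : ℕ) :
    kry (extT D) W (j + 1) =
      W ⊔ ((kry D (W.map (LinearMap.fst F V E)) j).map D).map (LinearMap.inl F V E) := by
  rw [← kry_fst, kry, extT, Submodule.map_comp, Submodule.map_comp]

/-- the subspace with first projection `W'`, intersection `K` with `E` and section `φ` -/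
def wof (W' : Submodule F V) (K : Submodule F E) (φ : W' →ₗ[F] E) : Submodule F (V × E) :=
  LinearMap.range (W'.subtype.prod φ) ⊔ K.map (LinearMap.inr F V E)

lemma mem_wof (W' : Submodule F V) (K : Submodule F E) (φ : W' →ₗ[F] E) (x : V × E) :
    x ∈ wof W' K φ ↔ ∃ h : x.1 ∈ W', x.2 - φ ⟨x.1, h⟩ ∈ K := by
  unfold wof
  rw [Submodule.mem_sup]
  constructor
  · rintro ⟨_, ⟨w, rfl⟩, _, ⟨k, hk, rfl⟩, rfl⟩
    simpa using hk
  · rintro ⟨h, hk⟩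
    refine ⟨_, ⟨⟨x.1, h⟩, rfl⟩, _, ⟨_, hk, rfl⟩, ?_⟩
    ext <;> simp

lemma wof_fst (W' : Submodule F V) (K : Submodule F E) (φ : W' →ₗ[F] E) :
    (wof W' K φ).map (LinearMap.fst F V E) = W' := by
  ext v
  simp only [Submodule.mem_map, mem_wof]
  constructor
  · rintro ⟨x, ⟨h, _⟩, rfl⟩; exact h
  · intro h; exact ⟨(v, φ ⟨v, h⟩), ⟨h, by simp⟩, rfl⟩

lemma wof_inr (W' : Submodule F V) (K : Submodule F E) (φ : W' →ₗ[F] E) :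
    (wof W' K φ).comap (LinearMap.inr F V E) = K := by
  ext e
  simp only [Submodule.mem_comap, mem_wof]
  have : ∀ h, φ (⟨0, h⟩ : W') = 0 := fun h => φ.map_zero
  simp [this]

lemma wof_mem (W' : Submodule F V) (K : Submodule F E) (φ : W' →ₗ[F] E) (w : W') :
    ((w : V), φ w) ∈ wof W' K φ := by
  simp [mem_wof]

lemma eq_wof (W : Submodule F (V × E)) (W' : Submodule F V)
    (hW : W.map (LinearMap.fst F V E) = W') (φ : W' →ₗ[F] E) (h : ∀ w : W', ((w : V), φ w) ∈ W) :
    W = wof W' (W.comap (LinearMap.inr F V E)) φ := by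
  ext x
  rw [mem_wof]
  have key : ∀ hx : x.1 ∈ W', x = ((x.1, φ ⟨x.1, hx⟩) : V × E) + (0, x.2 - φ ⟨x.1, hx⟩) := by
    intro hx; ext <;> simp
  constructor
  · intro hx
    have h1 : x.1 ∈ W' := hW ▸ ⟨x, hx, rfl⟩
    refine ⟨h1, ?_⟩
    have h2 := W.sub_mem hx (h ⟨x.1, h1⟩)
    rw [Submodule.mem_comap]
    convert h2 using 1
    ext <;> simp
  · rintro ⟨h1, h2⟩
    rw [key h1]
    exact W.add_mem (h ⟨x.1, h1⟩) h2

/-- The filtration on `W'`. -/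
def filt (D : V →ₗ[F] V) (W' : Submodule F V) (j : ℕ) : Submodule F W' :=
  ((kry D W' j).map D).comap W'.subtype

lemma kry_wof_inr (D : V →ₗ[F] V) (W' : Submodule F V) (K : Submodule F E) (φ : W' →ₗ[F] E) (j : ℕ) :
    (kry (extT D) (wof W' K φ) (j + 1)).comap (LinearMap.inr F V E) =
      K ⊔ (filt D W' j).map φ := by
  rw [kry_ext, wof_fst]
  ext e
  rw [Submodule.mem_comap, Submodule.mem_sup, Submodule.mem_sup]
  constructor
  · rintro ⟨x, hx, _, ⟨y, hy, rfl⟩, hxy⟩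
    obtain ⟨h1, h2⟩ := (mem_wof _ _ _ _).1 hx
    have e1 : x.1 + y = 0 := by simpa using congrArg Prod.fst hxy
    have e2 : x.2 = e := by simpa using congrArg Prod.snd hxy
    refine ⟨_, h2, φ ⟨x.1, h1⟩, ⟨⟨x.1, h1⟩, ?_, rfl⟩, by rw [← e2]; simp⟩
    change x.1 ∈ (kry D W' j).map D
    rw [eq_neg_of_add_eq_zero_left e1]
    exact Submodule.neg_mem _ hy
  · rintro ⟨k, hk, _, ⟨w, hw, rfl⟩, rfl⟩
    refine ⟨((w : V), φ w + k), (mem_wof _ _ _ _).2 ⟨w.2, by simpa using hk⟩, _,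
      ⟨-(w : V), Submodule.neg_mem _ hw, rfl⟩, ?_⟩
    ext
    · simp
    · simp [add_comm]

lemma filt_mono (D : V →ₗ[F] V) (W' : Submodule F V) : Monotone (filt D W') := fun _ _ h =>
  Submodule.comap_mono (Submodule.map_mono (kry_mono D W' h))

lemma filt_zero (D : V →ₗ[F] V) (W' : Submodule F V) : filt D W' 0 = ⊥ := by
  simp [filt, kry]

lemma finrank_filt (D : V →ₗ[F] V) (hD : Function.Injective D) (W' : Submodule F V) (j : ℕ) :
    finrank F (filt D W' j) + finrank F (kry D W' (j + 1)) = finrank F W' + finrank F (kry D W' j) := by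
  have h := Submodule.finrank_sup_add_finrank_inf_eq W' ((kry D W' j).map D)
  have h1 : finrank F ((kry D W' j).map D) = finrank F (kry D W' j) :=
    (Submodule.equivMapOfInjective D hD _).finrank_eq.symm
  have h2 : finrank F (filt D W' j) = finrank F (W' ⊓ (kry D W' j).map D : Submodule F V) := by
    rw [← Submodule.finrank_map_subtype_eq, filt, Submodule.map_comap_subtype]
  rw [h2, kry, ← h1]
  omega

end Fiber

section Fiber
variable {F V E : Type} [Field F] [Fintype F] [AddCommGroup V] [Module F V] [Finite V]
  [AddCommGroup E] [Module F E] [Finite E]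

lemma section_count (W : Submodule F (V × E)) (W' : Submodule F V)
    (hW : W.map (LinearMap.fst F V E) = W') :
    Nat.card {φ : W' →ₗ[F] E // ∀ w : W', ((w : V), φ w) ∈ W} =
      Fintype.card F ^ (finrank F W' * finrank F (W.comap (LinearMap.inr F V E))) := by
  have hmem : ∀ x : W, ((LinearMap.fst F V E).domRestrict W) x ∈ W' := fun x => hW ▸ ⟨x, x.2, rfl⟩
  let g : W →ₗ[F] W' := ((LinearMap.fst F V E).domRestrict W).codRestrict W' hmem
  have hg : LinearMap.range g = ⊤ := by
    rw [LinearMap.range_eq_top]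
    rintro ⟨w, hw⟩
    rw [← hW] at hw
    obtain ⟨x, hx, rfl⟩ := hw
    exact ⟨⟨x, hx⟩, rfl⟩
  obtain ⟨s, hs⟩ := LinearMap.exists_rightInverse_of_surjective g hg
  let φ₀ : W' →ₗ[F] E := LinearMap.snd F V E ∘ₗ W.subtype ∘ₗ s
  have hφ₀ : ∀ w : W', ((w : V), φ₀ w) ∈ W := by
    intro w
    have h1 : g (s w) = w := LinearMap.congr_fun hs w
    have h2 : ((s w : V × E)).1 = w := congrArg Subtype.val h1
    have h3 : ((w : V), φ₀ w) = (s w : V × E) := by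
      ext
      · exact h2.symm
      · rfl
    rw [h3]
    exact (s w).2
  let K := W.comap (LinearMap.inr F V E)
  have hK : ∀ e : E, e ∈ K ↔ ((0, e) : V × E) ∈ W := fun e => Iff.rfl
  let eqv : {φ : W' →ₗ[F] E // ∀ w : W', ((w : V), φ w) ∈ W} ≃ (W' →ₗ[F] K) :=
    { toFun := fun φ => (φ.1 - φ₀).codRestrict K (fun w => by
        rw [hK]
        have := W.sub_mem (φ.2 w) (hφ₀ w)
        simpa using this)
      invFun := fun ψ => ⟨φ₀ + K.subtype ∘ₗ ψ, fun w => by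
        have := W.add_mem (hφ₀ w) ((hK _).1 (ψ w).2)
        simpa using this⟩
      left_inv := fun φ => by
        ext w; simp
      right_inv := fun ψ => by
        ext w; simp }
  have := finite_hom (F := F) (V := W') (E := K)
  rw [Nat.card_congr eqv, Module.natCard_eq_pow_finrank (K := F), Module.finrank_linearMap,
    Nat.card_eq_fintype_card]

lemma kry_one (D : V →ₗ[F] V) (W' : Submodule F V) : kry D W' 1 = W' := by
  simp [kry]

lemma finrank_filt_of_prof (D : V →ₗ[F] V) (hD : Function.Injective D) (W' : Submodule F V)
    (ρ : ℕ →₀ ℕ) (hρ : Prof D ρ W') (j : ℕ) : finrank F (filt D W' j) + ρ j = ρ 0 := by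
  have h := finrank_filt D hD W' j
  have h1 := hρ 1
  rw [kry_one] at h1
  rw [hρ (j + 1), hρ j, h1, Finset.sum_range_succ] at h
  simp at h
  omega

lemma sum_sub (ρ μ : ℕ →₀ ℕ) (hle : ρ ≤ μ) (j : ℕ) :
    ∑ i ∈ Finset.range j, ρ i + ∑ i ∈ Finset.range j, (μ i - ρ i) = ∑ i ∈ Finset.range j, μ i := by
  rw [← Finset.sum_add_distrib]
  refine Finset.sum_congr rfl fun i _ => ?_
  have := hle i
  omega

lemma prof_wof (D : V →ₗ[F] V) (W' : Submodule F V)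
    (ρ μ : ℕ →₀ ℕ) (hρ : Prof D ρ W') (hle : ρ ≤ μ) (K : Submodule F E) (φ : W' →ₗ[F] E) :
    Prof (extT D) μ (wof W' K φ) ↔
      ∀ j, finrank F (K ⊔ (filt D W' j).map φ : Submodule F E) =
        ∑ i ∈ Finset.range (j + 1), (μ i - ρ i) := by
  have key : ∀ j, finrank F (kry (extT D) (wof W' K φ) (j + 1)) =
      ∑ i ∈ Finset.range (j + 1), ρ i + finrank F (K ⊔ (filt D W' j).map φ : Submodule F E) := by
    intro j
    rw [finrank_prod_sub, kry_fst, wof_fst, kry_wof_inr, hρ (j + 1)]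
  constructor
  · intro h j
    have h1 := h (j + 1)
    have h2 := sum_sub ρ μ hle (j + 1)
    rw [key] at h1
    omega
  · intro h j
    cases j with
    | zero => rw [kry, finrank_bot]; simp
    | succ j =>
      rw [key, h, sum_sub ρ μ hle]

lemma fiber_count (D : V →ₗ[F] V) (hD : Function.Injective D) (W' : Submodule F V)
    (ρ μ : ℕ →₀ ℕ) (hp : IsPtn ρ) (hρ : Prof D ρ W') (hle : ρ ≤ μ) (hs : ∀ i, μ (i + 1) ≤ ρ i)
    (n : ℕ) (hn : ρ n = 0) :
    (Nat.card {W : Submodule F (V × E) // W.map (LinearMap.fst F V E) = W' ∧ Prof (extT D) μ W} : ℚ) *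
      (Fintype.card F : ℚ) ^ (ρ 0 * (μ 0 - ρ 0)) =
    (Nat.card {K : Submodule F E // finrank F K = μ 0 - ρ 0} : ℚ) *
      ∏ i ∈ Finset.range n,
        (Polynomial.aeval (Fintype.card F : ℚ) (qbp (ρ i - ρ (i + 1)) (μ (i + 1) - ρ (i + 1))) *
        (Fintype.card F : ℚ) ^ ((ρ i - ρ (i + 1) - (μ (i + 1) - ρ (i + 1))) *
          ∑ l ∈ Finset.range (i + 1), (μ l - ρ l)) *
        ∏ l ∈ Finset.range (μ (i + 1) - ρ (i + 1)),
          ((Fintype.card F : ℚ) ^ finrank F E -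
            (Fintype.card F : ℚ) ^ (∑ l ∈ Finset.range (i + 1), (μ l - ρ l) + l))) := by
  have hfin := finite_hom (F := F) (V := W') (E := E)
  have hanti : Antitone ρ := antitone_nat_of_succ_le hp
  have hW' : finrank F W' = ρ 0 := by
    have h1 := hρ 1
    rw [kry_one] at h1
    simpa using h1
  have htop : filt D W' n = ⊤ := by
    apply Submodule.eq_top_of_finrank_eq
    have := finrank_filt_of_prof D hD W' ρ hρ n
    omega
  -- left-hand side
  rw [← card_prodSigma
    (fun W : Submodule F (V × E) => W.map (LinearMap.fst F V E) = W' ∧ Prof (extT D) μ W)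
    (fun (W : Submodule F (V × E)) (φ : W' →ₗ[F] E) => ∀ w : W', ((w : V), φ w) ∈ W)]
  rotate_left
  · rintro W ⟨h1, h2⟩
    rw [section_count W W' h1]
    have h3 := finrank_prod_sub W
    have h4 := h2 1
    rw [kry_one] at h4
    rw [h1, h4, hW'] at h3
    simp at h3
    have : finrank F (W.comap (LinearMap.inr F V E)) = μ 0 - ρ 0 := by omega
    rw [this, hW']
    push_cast; rfl
  -- right-hand side
  rw [← card_prodSigma
    (fun K : Submodule F E => finrank F K = μ 0 - ρ 0)
    (fun (K : Submodule F E) (φ : W' →ₗ[F] E) =>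
      ∀ i ≤ n, finrank F (K ⊔ (filt D W' i).map φ : Submodule F E) =
        ∑ l ∈ Finset.range (i + 1), (μ l - ρ l))]
  rotate_left
  · intro K hK
    rw [chain_count K (fun i => μ (i + 1) - ρ (i + 1)) (fun i => ∑ l ∈ Finset.range (i + 1), (μ l - ρ l))
      (by simp [hK]) (fun i => Finset.sum_range_succ _ _) n W' (filt D W') (filt_mono D W')
      (filt_zero D W') htop]
    refine Finset.prod_congr rfl fun i _ => ?_
    have h1 := finrank_filt_of_prof D hD W' ρ hρ i
    have h2 := finrank_filt_of_prof D hD W' ρ hρ (i + 1)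
    have h3 := hp i
    have : finrank F (filt D W' (i + 1)) - finrank F (filt D W' i) = ρ i - ρ (i + 1) := by omega
    rw [this]
  congr 1
  have hext : ∀ (K : Submodule F E) (φ : W' →ₗ[F] E),
      (finrank F K = μ 0 - ρ 0 ∧ ∀ i ≤ n, finrank F (K ⊔ (filt D W' i).map φ : Submodule F E) =
        ∑ l ∈ Finset.range (i + 1), (μ l - ρ l)) ↔ Prof (extT D) μ (wof W' K φ) := by
    intro K φ
    rw [prof_wof D W' ρ μ hρ hle]
    constructor
    · rintro ⟨_, h⟩ j
      rcases le_or_gt j n with hj | hj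
      · exact h j hj
      · have h1 : filt D W' j = ⊤ := top_le_iff.1 (htop ▸ filt_mono D W' hj.le)
        rw [h1, ← htop, h n le_rfl]
        refine Finset.sum_subset (by intro x; simp; omega) ?_
        intro x _ hx
        simp at hx
        obtain ⟨y, rfl⟩ : ∃ y, x = y + 1 := ⟨x - 1, by omega⟩
        have h2 := hs y
        have h3 := hanti (show n ≤ y by omega)
        omega
    · intro h
      refine ⟨?_, fun i _ => h i⟩
      have := h 0
      rw [filt_zero, Submodule.map_bot, sup_bot_eq] at this
      simpa using this
  refine Nat.card_congr
    { toFun := fun p => ⟨(p.1.1.comap (LinearMap.inr F V E), p.1.2), ?_⟩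
      invFun := fun p => ⟨(wof W' p.1.1 p.1.2, p.1.2), ?_⟩
      left_inv := ?_
      right_inv := ?_ }
  · obtain ⟨⟨W, φ⟩, ⟨h1, h2⟩, h3⟩ := p
    rw [hext]
    rw [eq_wof W W' h1 φ h3] at h2
    exact h2
  · obtain ⟨⟨K, φ⟩, h⟩ := p
    exact ⟨⟨wof_fst _ _ _, (hext K φ).1 h⟩, wof_mem _ _ _⟩
  · rintro ⟨⟨W, φ⟩, ⟨h1, h2⟩, h3⟩
    apply Subtype.ext
    exact Prod.ext (eq_wof W W' h1 φ h3).symm rfl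
  · rintro ⟨⟨K, φ⟩, h⟩
    apply Subtype.ext
    exact Prod.ext (wof_inr _ _ _) rfl

end Fiber

lemma prod_q (q : ℚ) (m : ℕ) : ∏ i ∈ Finset.range m, (q ^ m - q ^ i) =
    (q - 1) ^ m * q ^ (m.choose 2) * qFact q m := by
  induction m with
  | zero => simp [qFact]
  | succ m ih =>
    rw [Finset.prod_range_succ']
    have h1 : ∏ k ∈ Finset.range m, (q ^ (m + 1) - q ^ (k + 1)) = q ^ m * ∏ i ∈ Finset.range m, (q ^ m - q ^ i) := by
      have : ∀ k ∈ Finset.range m, (q ^ (m + 1) - q ^ (k + 1)) = q * (q ^ m - q ^ k) := by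
        intro k _; ring
      rw [Finset.prod_congr rfl this, Finset.prod_mul_distrib]
      simp
    have h2 : q ^ (m + 1) - q ^ 0 = (q - 1) * qNat q (m + 1) := by
      unfold qNat
      rw [mul_comm, geom_sum_mul]
      simp
    have h3 : qFact q (m + 1) = qFact q m * qNat q (m + 1) := Finset.prod_range_succ _ _
    have h4 : (m + 1).choose 2 = m.choose 2 + m := by
      rw [Nat.choose_succ_succ' m 1, Nat.choose_one_right, add_comm]
    rw [h1, h2, h3, h4, ih]
    ring

lemma choose_two_add (a b : ℕ) : (a + b).choose 2 = a.choose 2 + b.choose 2 + a * b := by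
  induction b with
  | zero => simp
  | succ b ih =>
    have h4 : ∀ m : ℕ, (m + 1).choose 2 = m.choose 2 + m := by
      intro m
      rw [Nat.choose_succ_succ' m 1, Nat.choose_one_right, add_comm]
    rw [← add_assoc, h4, h4, ih]
    ring

lemma exponent_id (ρ μ : ℕ → ℕ) (hp : ∀ i, ρ (i + 1) ≤ ρ i) (hle : ∀ i, ρ i ≤ μ i)
    (hs : ∀ i, μ (i + 1) ≤ ρ i) (n : ℕ) :
    (μ 0 - ρ 0) * ρ 0 + ∑ j ∈ Finset.range n, ((μ (j + 1)).choose 2 - (ρ (j + 1)).choose 2) +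
      (μ 0 - ρ 0).choose 2 =
    ∑ i ∈ Finset.range n, ((ρ i - ρ (i + 1) - (μ (i + 1) - ρ (i + 1))) *
          ∑ l ∈ Finset.range (i + 1), (μ l - ρ l)) +
      (∑ l ∈ Finset.range (n + 1), (μ l - ρ l)).choose 2 +
      (∑ l ∈ Finset.range (n + 1), (μ l - ρ l)) * ρ n := by
  induction n with
  | zero => simp; ring
  | succ n ih =>
    rw [Finset.sum_range_succ, Finset.sum_range_succ (fun i => (ρ i - ρ (i + 1) - (μ (i + 1) - ρ (i + 1))) *
          ∑ l ∈ Finset.range (i + 1), (μ l - ρ l)), Finset.sum_range_succ (fun l => μ l - ρ l) (n + 1)]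
    set e := ∑ l ∈ Finset.range (n + 1), (μ l - ρ l)
    obtain ⟨d, hd⟩ := Nat.exists_eq_add_of_le (hle (n + 1))
    have h1 := hs n
    obtain ⟨c, hc⟩ := Nat.exists_eq_add_of_le h1
    have h2 : (μ (n + 1)).choose 2 - (ρ (n + 1)).choose 2 = d.choose 2 + ρ (n + 1) * d := by
      rw [hd, choose_two_add]; omega
    have h3 : μ (n + 1) - ρ (n + 1) = d := by omega
    have h4 : ρ n - ρ (n + 1) - d = c := by omega
    rw [h2, h3, h4, choose_two_add]
    have h5 : ρ n = ρ (n + 1) + d + c := by omega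
    rw [h5] at ih
    linarith [ih]

lemma qFact_pos (q : ℚ) (hq : 0 < q) (m : ℕ) : 0 < qFact q m := by
  refine Finset.prod_pos fun i _ => ?_
  unfold qNat
  rw [Finset.sum_range_succ']
  have : 0 ≤ ∑ k ∈ Finset.range i, q ^ (k + 1) := Finset.sum_nonneg fun k _ => by positivity
  simp; linarith

lemma telescoping (q : ℚ) (m : ℕ) (δ : ℕ → ℕ) (n : ℕ) :
    (∏ i ∈ Finset.range (δ 0), (q ^ m - q ^ i)) *
      ∏ i ∈ Finset.range n, ∏ l ∈ Finset.range (δ (i + 1)),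
        (q ^ m - q ^ (∑ l ∈ Finset.range (i + 1), δ l + l)) =
    ∏ i ∈ Finset.range (∑ l ∈ Finset.range (n + 1), δ l), (q ^ m - q ^ i) := by
  induction n with
  | zero => simp
  | succ n ih =>
    rw [Finset.prod_range_succ, ← mul_assoc, ih, Finset.sum_range_succ _ (n + 1), Finset.prod_range_add]

/-- coefficient with finite products -/
noncomputable def coefN (q : ℚ) (μ ρ : ℕ →₀ ℕ) (m n : ℕ) : ℚ :=
  (qFact q m / qFact q (μ 0 - ρ 0) *
    ∏ i ∈ Finset.range n, Polynomial.aeval q (qbp (ρ i - ρ (i + 1)) (μ (i + 1) - ρ (i + 1)))) *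
    (q - 1) ^ (∑ j ∈ Finset.range n, (μ (j + 1) - ρ (j + 1))) *
    q ^ (∑ j ∈ Finset.range n, ((μ (j + 1)).choose 2 - (ρ (j + 1)).choose 2))

section
variable {F V E : Type} [Field F] [Fintype F] [AddCommGroup V] [Module F V] [Finite V]
  [AddCommGroup E] [Module F E] [Finite E]

lemma fiber_count' (D : V →ₗ[F] V) (hD : Function.Injective D) (W' : Submodule F V)
    (ρ μ : ℕ →₀ ℕ) (hp : IsPtn ρ) (hρ : Prof D ρ W') (hle : ρ ≤ μ) (hs : ∀ i, μ (i + 1) ≤ ρ i)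
    (n : ℕ) (hn : ρ n = 0) (hm : finrank F E = ∑ l ∈ Finset.range (n + 1), (μ l - ρ l)) :
    (Nat.card {W : Submodule F (V × E) // W.map (LinearMap.fst F V E) = W' ∧ Prof (extT D) μ W} : ℚ) =
      coefN (Fintype.card F) μ ρ (finrank F E) n := by
  have h1 := fiber_count (E := E) D hD W' ρ μ hp hρ hle hs n hn
  have hd : μ 0 - ρ 0 ≤ finrank F E := by
    rw [hm, Finset.sum_range_succ']; omega
  have h2 := card_subspaces (F := F) (E := E) (μ 0 - ρ 0) hd
  have h3 := telescoping (Fintype.card F : ℚ) (finrank F E) (fun i => μ i - ρ i) n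
  have h4 := exponent_id ρ μ hp hle hs n
  rw [hn, mul_zero, add_zero] at h4
  simp only [← hm] at h3 h4
  rw [← h2, prod_q, prod_q] at h3
  have hq1 : (1 : ℚ) < Fintype.card F := by exact_mod_cast Fintype.one_lt_card
  rw [Finset.prod_mul_distrib, Finset.prod_mul_distrib, Finset.prod_pow_eq_pow_sum] at h1
  have h5 : finrank F E = ∑ j ∈ Finset.range n, (μ (j + 1) - ρ (j + 1)) + (μ 0 - ρ 0) := by
    rw [hm, Finset.sum_range_succ']
  unfold coefN
  set q : ℚ := (Fintype.card F : ℚ)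
  set m := finrank F E
  set d := μ 0 - ρ 0
  set fib : ℚ := (Nat.card {W : Submodule F (V × E) // W.map (LinearMap.fst F V E) = W' ∧ Prof (extT D) μ W} : ℚ)
  set kk : ℚ := (Nat.card {K : Submodule F E // finrank F K = d} : ℚ)
  set B := ∏ i ∈ Finset.range n, Polynomial.aeval q (qbp (ρ i - ρ (i + 1)) (μ (i + 1) - ρ (i + 1)))
  set P := ∏ i ∈ Finset.range n, ∏ l ∈ Finset.range (μ (i + 1) - ρ (i + 1)),
          (q ^ m - q ^ (∑ l ∈ Finset.range (i + 1), (μ l - ρ l) + l))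
  set s := ∑ j ∈ Finset.range n, (μ (j + 1) - ρ (j + 1))
  set a := ∑ i ∈ Finset.range n, ((ρ i - ρ (i + 1) - (μ (i + 1) - ρ (i + 1))) *
          ∑ l ∈ Finset.range (i + 1), (μ l - ρ l))
  set c := ∑ j ∈ Finset.range n, ((μ (j + 1)).choose 2 - (ρ (j + 1)).choose 2)
  have hq0 : q ≠ 0 := by linarith
  have hq2 : q - 1 ≠ 0 := by linarith
  have hf := (qFact_pos q (by linarith) d).ne'
  have hx : q ^ (ρ 0 * d) * ((q - 1) ^ d * q ^ d.choose 2 * qFact q d) ≠ 0 := by positivity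
  apply mul_right_cancel₀ hx
  calc fib * (q ^ (ρ 0 * d) * ((q - 1) ^ d * q ^ d.choose 2 * qFact q d))
      = (fib * q ^ (ρ 0 * d)) * ((q - 1) ^ d * q ^ d.choose 2 * qFact q d) := by ring
    _ = B * q ^ a * (kk * ((q - 1) ^ d * q ^ d.choose 2 * qFact q d) * P) := by rw [h1]; ring
    _ = B * q ^ a * ((q - 1) ^ m * q ^ m.choose 2 * qFact q m) := by rw [h3]
    _ = B * (q - 1) ^ m * qFact q m * q ^ (a + m.choose 2) := by rw [pow_add]; ring
    _ = _ := by
      rw [← h4, h5]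
      field_simp
      ring
end

lemma ptnSize_eq (ρ : ℕ →₀ ℕ) (n : ℕ) (h : ∀ i, n ≤ i → ρ i = 0) :
    ptnSize ρ = ∑ i ∈ Finset.range n, ρ i := by
  unfold ptnSize
  apply Finsupp.sum_of_support_subset
  · intro i hi
    simp at hi ⊢
    by_contra hc
    exact hi (h i (by omega))
  · simp

lemma exists_bound (ρ : ℕ →₀ ℕ) : ∃ n, ∀ i, n ≤ i → ρ i = 0 := by
  refine ⟨ρ.support.sup id + 1, fun i hi => ?_⟩
  by_contra hc
  have : i ≤ ρ.support.sup id := Finset.le_sup (f := id) (by simpa using hc)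
  omega

section
variable {F V E : Type} [Field F] [Fintype F] [AddCommGroup V] [Module F V] [Finite V]
  [AddCommGroup E] [Module F E] [Finite E]

lemma strip_exists (D : V →ₗ[F] V) (hD : Function.Injective D) (μ : ℕ →₀ ℕ)
    (hμ : ptnSize μ = finrank F V + finrank F E) (W : Submodule F (V × E))
    (hW : Prof (extT D) μ W) :
    ∃ ρ : ℕ →₀ ℕ, Prof D ρ (W.map (LinearMap.fst F V E)) ∧ IsPtn ρ ∧ ptnSize ρ = finrank F V ∧
      ρ ≤ μ ∧ ∀ i, μ (i + 1) ≤ ρ i := by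
  set W' := W.map (LinearMap.fst F V E) with hW'
  obtain ⟨n, hn⟩ := exists_bound μ
  have htop : kry (extT D) W n = ⊤ := by
    apply Submodule.eq_top_of_finrank_eq
    rw [hW n, ← ptnSize_eq μ n hn, hμ, Module.finrank_prod]
  have htop' : kry D W' n = ⊤ := by
    rw [hW', ← kry_fst, htop, Submodule.map_top, Submodule.range_fst]
  have htop'' : ∀ j, n ≤ j → kry D W' j = ⊤ := fun j hj => top_le_iff.1 (htop' ▸ kry_mono D W' hj)
  have hmono : ∀ j, finrank F (kry D W' j) ≤ finrank F (kry D W' (j + 1)) := fun j =>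
    Submodule.finrank_mono (kry_le_succ D W' j)
  let ρ : ℕ →₀ ℕ := Finsupp.onFinset (Finset.range n)
    (fun j => finrank F (kry D W' (j + 1)) - finrank F (kry D W' j)) (by
      intro j hj
      by_contra hc
      simp at hc
      apply hj
      rw [htop'' j hc, htop'' (j + 1) (by omega)]
      simp)
  have hρ : ∀ j, finrank F (kry D W' (j + 1)) = finrank F (kry D W' j) + ρ j := by
    intro j
    have : ρ j = finrank F (kry D W' (j + 1)) - finrank F (kry D W' j) := rfl
    have := hmono j
    omega
  have hprof : Prof D ρ W' := by
    intro j
    induction j with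
    | zero => rw [kry, finrank_bot]; simp
    | succ j ih => rw [hρ, ih, Finset.sum_range_succ]
  have hμs : ∀ j, finrank F (kry (extT D) W (j + 1)) = finrank F (kry (extT D) W j) + μ j := by
    intro j
    rw [hW, hW, Finset.sum_range_succ]
  refine ⟨ρ, hprof, ?_, ?_, ?_, ?_⟩
  · intro i
    have h1 := finrank_filt_of_prof D hD W' ρ hprof i
    have h2 := finrank_filt_of_prof D hD W' ρ hprof (i + 1)
    have h3 := Submodule.finrank_mono (filt_mono D W' (Nat.le_succ i))
    have h4 : finrank F (filt D W' i) ≤ finrank F (filt D W' (i + 1)) := h3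
    omega
  · have hz : ∀ i, n ≤ i → ρ i = 0 := by
      intro i hi
      have := hρ i
      rw [htop'' i hi, htop'' (i + 1) (by omega)] at this
      omega
    rw [ptnSize_eq ρ n hz, ← hprof n, htop', finrank_top]
  · intro j
    have h1 := finrank_prod_sub (kry (extT D) W (j + 1))
    have h2 := finrank_prod_sub (kry (extT D) W j)
    rw [kry_fst, ← hW'] at h1 h2
    have h3 : finrank F ((kry (extT D) W j).comap (LinearMap.inr F V E)) ≤
        finrank F ((kry (extT D) W (j + 1)).comap (LinearMap.inr F V E)) :=
      Submodule.finrank_mono (Submodule.comap_mono (kry_le_succ _ _ _))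
    have h4 := hρ j
    have h5 := hμs j
    omega
  · intro j
    have hX : ∀ j, finrank F (((kry D W' j).map D).map (LinearMap.inl F V E)) = finrank F (kry D W' j) := by
      intro j
      rw [← (Submodule.equivMapOfInjective (LinearMap.inl F V E) LinearMap.inl_injective _).finrank_eq,
        ← (Submodule.equivMapOfInjective D hD _).finrank_eq]
    have h1 := Submodule.finrank_sup_add_finrank_inf_eq W (((kry D W' j).map D).map (LinearMap.inl F V E))
    have h2 := Submodule.finrank_sup_add_finrank_inf_eq W (((kry D W' (j + 1)).map D).map (LinearMap.inl F V E))
    rw [hX, ← kry_ext] at h1 h2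
    have h3 : finrank F (W ⊓ ((kry D W' j).map D).map (LinearMap.inl F V E) : Submodule F (V × E)) ≤
        finrank F (W ⊓ ((kry D W' (j + 1)).map D).map (LinearMap.inl F V E) : Submodule F (V × E)) :=
      Submodule.finrank_mono (inf_le_inf_left _ (Submodule.map_mono (Submodule.map_mono (kry_le_succ _ _ _))))
    have h4 := hρ j
    have h5 := hμs (j + 1)
    omega
end

/-- coefficient, as in the statement -/
noncomputable def coefS (q : ℚ) (μ ρ : ℕ →₀ ℕ) : ℚ :=
  (qFact q (ptnSize μ - ptnSize ρ) / qFact q (μ 0 - ρ 0) *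
            ∏ᶠ i : ℕ, Polynomial.aeval q (qbp (ρ i - ρ (i + 1)) (μ (i + 1) - ρ (i + 1)))) *
          (q - 1) ^ (∑ᶠ j : ℕ, (μ (j + 1) - ρ (j + 1))) *
          q ^ (∑ᶠ j : ℕ, ((μ (j + 1)).choose 2 - (ρ (j + 1)).choose 2))

lemma coefS_eq (q : ℚ) (μ ρ : ℕ →₀ ℕ) (hs : ∀ i, μ (i + 1) ≤ ρ i) (n : ℕ)
    (hn : ∀ i, n ≤ i → ρ i = 0) : coefS q μ ρ = coefN q μ ρ (ptnSize μ - ptnSize ρ) n := by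
  have hz : ∀ i, n ≤ i → μ (i + 1) = 0 ∧ ρ (i + 1) = 0 ∧ ρ i = 0 := by
    intro i hi
    have h1 := hn i hi
    have h2 := hn (i + 1) (by omega)
    have h3 := hs i
    omega
  unfold coefS coefN
  rw [finprod_eq_prod_of_mulSupport_subset (s := Finset.range n),
    finsum_eq_sum_of_support_subset (s := Finset.range n),
    finsum_eq_sum_of_support_subset (s := Finset.range n)]
  all_goals
    intro i hi
    simp only [Finset.coe_range, Set.mem_Iio]
    by_contra hc
    obtain ⟨h1, h2, h3⟩ := hz i (by omega)
    apply hi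
    simp [h1, h2, h3, qbp_zero_right]

/-- index set of the sum -/
def stripSet (N' : ℕ) (μ : ℕ →₀ ℕ) : Set (ℕ →₀ ℕ) :=
  {ρ : ℕ →₀ ℕ | IsPtn ρ ∧ ptnSize ρ = N' ∧ ρ ≤ μ ∧ ∀ i, μ (i + 1) ≤ ρ i}

lemma stripSet_finite (N' : ℕ) (μ : ℕ →₀ ℕ) : (stripSet N' μ).Finite :=
  (Set.finite_Iic μ).subset fun _ h => h.2.2.1

section
variable {F V E : Type} [Field F] [Fintype F] [AddCommGroup V] [Module F V] [Finite V]
  [AddCommGroup E] [Module F E] [Finite E]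

lemma prof_unique (D : V →ₗ[F] V) (W : Submodule F V) (ρ ρ' : ℕ →₀ ℕ) (h : Prof D ρ W)
    (h' : Prof D ρ' W) : ρ = ρ' := by
  ext i
  have h1 := h i
  have h2 := h' i
  have h3 := h (i + 1)
  have h4 := h' (i + 1)
  rw [Finset.sum_range_succ] at h3 h4
  omega

lemma recursion (D : V →ₗ[F] V) (hD : Function.Injective D) (μ : ℕ →₀ ℕ)
    (hμ : ptnSize μ = finrank F V + finrank F E) :
    (sig μ (extT (E := E) D) : ℚ) =
      ∑ᶠ ρ ∈ stripSet (finrank F V) μ, coefS (Fintype.card F) μ ρ * (sig ρ D : ℚ) := by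
  have : Fintype (Submodule F V) := Fintype.ofFinite _
  have hfin := stripSet_finite (finrank F V) μ
  rw [finsum_mem_eq_finite_toFinset_sum _ hfin]
  have e1 : {W : Submodule F (V × E) // Prof (extT D) μ W} ≃ Σ W' : Submodule F V,
      {W : Submodule F (V × E) // W.map (LinearMap.fst F V E) = W' ∧ Prof (extT D) μ W} :=
    { toFun := fun W => ⟨W.1.map (LinearMap.fst F V E), W.1, rfl, W.2⟩
      invFun := fun p => ⟨p.2.1, p.2.2.2⟩
      left_inv := fun W => rfl
      right_inv := by
        rintro ⟨W', W, rfl, h⟩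
        rfl }
  unfold sig
  rw [Nat.card_congr e1, Nat.card_sigma]
  have h2 : ∀ ρ : ℕ →₀ ℕ, (Nat.card {W' : Submodule F V // Prof D ρ W'} : ℚ) =
      ∑ W' : Submodule F V, if Prof D ρ W' then (1 : ℚ) else 0 := by
    intro ρ
    rw [Nat.card_eq_fintype_card, Fintype.card_subtype]
    simp
  simp only [h2, Finset.mul_sum]
  rw [Finset.sum_comm]
  push_cast
  refine Finset.sum_congr rfl fun W' _ => ?_
  by_cases hex : ∃ ρ ∈ stripSet (finrank F V) μ, Prof D ρ W'
  · obtain ⟨ρ, hρ, hprof⟩ := hex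
    rw [Finset.sum_eq_single ρ]
    · rw [if_pos hprof, mul_one]
      obtain ⟨hp, hsz, hle, hs⟩ := hρ
      obtain ⟨n, hn⟩ := exists_bound ρ
      rw [coefS_eq _ μ ρ hs n hn]
      have hμ0 : ∀ i, n + 1 ≤ i → μ i = 0 := by
        intro i hi
        obtain ⟨y, rfl⟩ : ∃ y, i = y + 1 := ⟨i - 1, by omega⟩
        have h1 := hs y
        have h2 := hn y (by omega)
        omega
      have hE : ptnSize μ - ptnSize ρ = finrank F E := by omega
      rw [hE]
      refine fiber_count' D hD W' ρ μ hp hprof hle hs n (hn n le_rfl) ?_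
      have h3 := sum_sub ρ μ hle (n + 1)
      rw [← ptnSize_eq μ (n + 1) hμ0, ← ptnSize_eq ρ (n + 1) (fun i hi => hn i (by omega))] at h3
      omega
    · intro ρ' _ hne
      rw [if_neg, mul_zero]
      intro h
      exact hne (prof_unique D W' ρ' ρ h hprof)
    · intro h
      exact absurd (hfin.mem_toFinset.2 hρ) h
  · rw [Finset.sum_eq_zero]
    · have : IsEmpty {W : Submodule F (V × E) // W.map (LinearMap.fst F V E) = W' ∧ Prof (extT D) μ W} := by
        refine ⟨?_⟩
        rintro ⟨W, rfl, hW⟩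
        obtain ⟨ρ, h1, h2, h3, h4, h5⟩ := strip_exists D hD μ hμ W hW
        exact hex ⟨ρ, ⟨h2, h3, h4, h5⟩, h1⟩
      simp
    · intro ρ hρ
      rw [if_neg, mul_zero]
      intro h
      exact hex ⟨ρ, hfin.mem_toFinset.1 hρ, h⟩
end

section Model
variable {F : Type} [Field F]

/-- model space -/
abbrev Mdl (F : Type) (k : ℕ) (ν : ℕ → ℕ) : Type := (i : Fin k) → (Fin (ν i) → F)

/-- the diagonal endomorphism of the model space -/
def diagM (k : ℕ) (ν : ℕ → ℕ) (a : ℕ → F) : Mdl F k ν →ₗ[F] Mdl F k ν where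
  toFun f i := a i • f i
  map_add' f g := by ext i; simp [mul_add]
  map_smul' c f := by ext i; simp; ring

lemma finrank_Mdl (k : ℕ) (ν : ℕ → ℕ) : finrank F (Mdl F k ν) = ∑ i ∈ Finset.range k, ν i := by
  rw [Module.finrank_pi_fintype, Finset.sum_range]
  simp

/-- splitting off the last block -/
def mdlEquiv (k : ℕ) (ν : ℕ → ℕ) : Mdl F (k + 1) ν ≃ₗ[F] Mdl F k ν × (Fin (ν k) → F) where
  toFun f := (fun i => f i.castSucc, f (Fin.last k))
  invFun p := Fin.snoc (α := fun i : Fin (k + 1) => (Fin (ν i) → F)) p.1 p.2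
  map_add' f g := rfl
  map_smul' c f := rfl
  left_inv f := by
    funext i
    refine Fin.lastCases ?_ (fun i => ?_) i <;> simp
  right_inv p := by
    ext i <;> simp

lemma recursion_mdl [Fintype F] (k : ℕ) (ν : ℕ → ℕ) (a : ℕ → F) (ha : ∀ i < k, a i ≠ a k)
    (μ : ℕ →₀ ℕ) (hμ : ptnSize μ = ∑ i ∈ Finset.range (k + 1), ν i) :
    (sig μ (diagM (k + 1) ν a) : ℚ) =
      ∑ᶠ ρ ∈ stripSet (∑ i ∈ Finset.range k, ν i) μ,
        coefS (Fintype.card F) μ ρ * (sig ρ (diagM k ν a) : ℚ) := by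
  set D : Mdl F k ν →ₗ[F] Mdl F k ν := diagM k ν a + (- a k) • LinearMap.id with hDdef
  have hDap : ∀ f i, D f i = (a i - a k) • f i := by
    intro f i
    simp [hDdef, diagM, sub_smul]
    ext; simp; ring
  have hD : Function.Injective D := by
    rw [← LinearMap.ker_eq_bot, LinearMap.ker_eq_bot']
    intro f hf
    ext1 i
    have h1 := congrFun hf i
    rw [hDap] at h1
    exact (smul_eq_zero.1 h1).resolve_left (sub_ne_zero.2 (ha i i.2))
  have h := recursion (E := Fin (ν k) → F) D hD μ (by
    rw [hμ, finrank_Mdl, Finset.sum_range_succ]; simp)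
  rw [finrank_Mdl] at h
  simp only [hDdef, sig_shift] at h
  rw [← h, ← hDdef, ← sig_shift μ (diagM (k + 1) ν a) (- a k)]
  congr 1
  refine sig_conj μ _ _ (mdlEquiv k ν) ?_
  intro f
  refine Prod.ext ?_ ?_
  · ext1 i
    change _ = D (fun i : Fin k => f i.castSucc) i
    rw [hDap]
    simp [mdlEquiv, diagM, sub_smul]
    ext; simp; ring
  · ext1 i
    simp [mdlEquiv, diagM, extT]

lemma sig_indep [Fintype F] (ν : ℕ → ℕ) (a b : ℕ → F) (k : ℕ) (ha : ∀ i < k, ∀ j < k, a i = a j → i = j)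
    (hb : ∀ i < k, ∀ j < k, b i = b j → i = j) (μ : ℕ →₀ ℕ)
    (hμ : ptnSize μ = ∑ i ∈ Finset.range k, ν i) :
    sig μ (diagM k ν a) = sig μ (diagM k ν b) := by
  induction k generalizing μ with
  | zero =>
    congr 1
    exact LinearMap.ext fun f => funext fun i => i.elim0
  | succ k ih =>
    have h1 := recursion_mdl k ν a (fun i hi h => absurd (ha i (by omega) k (by omega) h) (by omega)) μ hμ
    have h2 := recursion_mdl k ν b (fun i hi h => absurd (hb i (by omega) k (by omega) h) (by omega)) μ hμ
    have h3 : (sig μ (diagM (k + 1) ν a) : ℚ) = sig μ (diagM (k + 1) ν b) := by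
      rw [h1, h2]
      refine finsum_mem_congr rfl fun ρ hρ => ?_
      rw [ih (fun i hi j hj => ha i (by omega) j (by omega))
        (fun i hi j hj => hb i (by omega) j (by omega)) ρ hρ.2.1]
    exact_mod_cast h3

lemma sig_model {V : Type} [AddCommGroup V] [Module F V] [Module.Finite F V] (T : V →ₗ[F] V)
    (k : ℕ) (ν : ℕ → ℕ) (a : ℕ → F)
    (htop : (⨆ i : Fin k, Module.End.eigenspace T (a i)) = ⊤)
    (hdim : ∀ i < k, finrank F (Module.End.eigenspace T (a i)) = ν i)
    (hV : finrank F V = ∑ i ∈ Finset.range k, ν i) (μ : ℕ →₀ ℕ) :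
    sig μ T = sig μ (diagM k ν a) := by
  have he : ∀ i : Fin k, Nonempty ((Fin (ν i) → F) ≃ₗ[F] Module.End.eigenspace T (a i)) := by
    intro i
    apply FiniteDimensional.nonempty_linearEquiv_of_finrank_eq
    rw [hdim i i.2]; simp
  let e := fun i => (he i).some
  let g : Mdl F k ν →ₗ[F] V :=
    ∑ i : Fin k, (Module.End.eigenspace T (a i)).subtype ∘ₗ (e i).toLinearMap ∘ₗ LinearMap.proj i
  have hg : ∀ f, g f = ∑ i : Fin k, (e i (f i) : V) := by
    intro f; simp [g]
  have hsurj : Function.Surjective g := by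
    rw [← LinearMap.range_eq_top, eq_top_iff, ← htop]
    refine iSup_le fun i x hx => ?_
    refine ⟨Pi.single i ((e i).symm ⟨x, hx⟩), ?_⟩
    rw [hg, Finset.sum_eq_single i]
    · simp
    · intro j _ hj
      rw [Pi.single_eq_of_ne hj]; simp
    · simp
  have hinj : Function.Injective g :=
    (LinearMap.injective_iff_surjective_of_finrank_eq_finrank (by rw [finrank_Mdl, hV])).2 hsurj
  symm
  refine sig_conj μ _ _ (LinearEquiv.ofBijective g ⟨hinj, hsurj⟩) ?_
  intro f
  change g (diagM k ν a f) = T (g f)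
  rw [hg, hg, map_sum]
  refine Finset.sum_congr rfl fun i _ => ?_
  have h1 := Module.End.mem_eigenspace_iff.1 (e i (f i)).2
  rw [h1]
  simp [diagM]

end Model

lemma support_eq_range (ν : ℕ →₀ ℕ) (hν : IsPtn ν) : ν.support = Finset.range ν.support.card := by
  have hanti : Antitone ν := antitone_nat_of_succ_le hν
  have hl : ∀ i ∈ ν.support, Finset.range (i + 1) ⊆ ν.support := by
    intro i hi j hj
    simp at hi hj ⊢
    have := hanti (show j ≤ i by omega)
    omega
  refine Finset.eq_of_subset_of_card_le ?_ (by simp)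
  intro i hi
  have := Finset.card_le_card (hl i hi)
  simp at this ⊢
  omega

lemma sigmaProf_model {F : Type} [Field F] {n : ℕ} (Δ : Matrix (Fin n) (Fin n) F) (ν : ℕ →₀ ℕ)
    (hΔ : DiagOfType Δ ν) (k : ℕ) (hk : ν.support = Finset.range k) (hn : n = ∑ i ∈ Finset.range k, ν i) :
    ∃ a : ℕ → F, (∀ i < k, ∀ j < k, a i = a j → i = j) ∧
      ∀ μ, sigmaProf μ Δ = sig μ (diagM k ν a) := by
  obtain ⟨a, h1, h2, h3⟩ := hΔ
  rw [hk] at h1 h2 h3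
  refine ⟨a, fun i hi j hj h => h1 (by simpa using hi) (by simpa using hj) h, fun μ => ?_⟩
  rw [sigmaProf_eq]
  refine sig_model _ k ν a ?_ (fun i hi => h3 i (by simpa using hi)) (by simpa using hn) μ
  rw [← h2]
  apply le_antisymm
  · exact iSup_le fun i => le_iSup₂_of_le (i : ℕ) (by simp) le_rfl
  · exact iSup₂_le fun i hi => le_iSup_of_le (⟨i, by simpa using hi⟩ : Fin k) le_rfl

/-- recursion for diagonalizable types. With `ν` a partition with `k ≥ 1`
nonzero parts, `ν̃` obtained by deleting the last part, `Δ` diagonalizable of type `ν` and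
`Δ'` diagonalizable of type `ν̃`, `σ(μ,Δ)` is the horizontal-strip sum of
`θ_{μ/ρ}(q) (q-1)^{∑_{j≥2}(μ_j-ρ_j)} q^{∑_{j≥2}(C(μ_j,2)-C(ρ_j,2))} σ(ρ,Δ')`. -/
theorem statement13 (q : ℕ) (hq : IsPrimePow q) (k : ℕ) (hk : 0 < k)
    (ν : ℕ →₀ ℕ) (hν : IsPtn ν) (hνk : ν.support.card = k)
    (N N' : ℕ) (hN : ptnSize ν = N) (hN' : N' = N - ν (k - 1))
    (F : Type) [Field F] [Fintype F] (hF : Fintype.card F = q)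
    (Δ : Matrix (Fin N) (Fin N) F) (hΔ : DiagOfType Δ ν)
    (Δ' : Matrix (Fin N') (Fin N') F) (hΔ' : DiagOfType Δ' (ν.erase (k - 1)))
    (μ : ℕ →₀ ℕ) (hμ : IsPtn μ) (hμN : ptnSize μ = N) :
    (sigmaProf μ Δ : ℚ) =
      ∑ᶠ ρ ∈ {ρ : ℕ →₀ ℕ | IsPtn ρ ∧ ptnSize ρ = N' ∧ ρ ≤ μ ∧ ∀ i, μ (i + 1) ≤ ρ i},
        (qFact (q : ℚ) (ptnSize μ - ptnSize ρ) / qFact (q : ℚ) (μ 0 - ρ 0) *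
            ∏ᶠ i : ℕ, Polynomial.aeval (q : ℚ) (qbp (ρ i - ρ (i + 1)) (μ (i + 1) - ρ (i + 1)))) *
          ((q : ℚ) - 1) ^ (∑ᶠ j : ℕ, (μ (j + 1) - ρ (j + 1))) *
          (q : ℚ) ^ (∑ᶠ j : ℕ, ((μ (j + 1)).choose 2 - (ρ (j + 1)).choose 2)) *
          (sigmaProf ρ Δ' : ℚ) := by
  subst hF
  obtain ⟨k, rfl⟩ : ∃ l, k = l + 1 := ⟨k - 1, by omega⟩
  simp only [Nat.add_sub_cancel] at hN' hΔ'
  have hsup := support_eq_range ν hν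
  rw [hνk] at hsup
  have hz : ∀ i, k + 1 ≤ i → ν i = 0 := by
    intro i hi
    have : i ∉ ν.support := by rw [hsup]; simpa using hi
    simpa using this
  have hNs : N = ∑ i ∈ Finset.range (k + 1), ν i := by rw [← hN, ptnSize_eq ν (k + 1) hz]
  have hN's : N' = ∑ i ∈ Finset.range k, ν i := by
    rw [hN', hNs, Finset.sum_range_succ]; omega
  have hsup' : (ν.erase k).support = Finset.range k := by
    rw [Finsupp.support_erase, hsup]
    ext i; simp; omega
  have herase : ∀ i ∈ Finset.range k, (ν.erase k) i = ν i := by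
    intro i hi
    simp at hi
    exact Finsupp.erase_ne (by omega)
  obtain ⟨a, ha, hσ⟩ := sigmaProf_model Δ ν hΔ (k + 1) hsup hNs
  obtain ⟨b, hb, hσ'⟩ := sigmaProf_model Δ' (ν.erase k) hΔ' k hsup'
    (by rw [hN's, Finset.sum_congr rfl herase])
  have hswap : ∀ ρ : ℕ →₀ ℕ, sig ρ (diagM k (ν.erase k) b) = sig ρ (diagM k ν b) := by
    intro ρ
    have hc : ∀ i : Fin k, (ν.erase k) i = ν i := fun i => herase i (by simp)
    refine sig_conj ρ _ _ (LinearEquiv.piCongrRight fun i : Fin k =>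
      LinearEquiv.funCongrLeft F F (finCongr (hc i).symm)) ?_
    intro f
    ext i l
    simp [diagM, LinearEquiv.funCongrLeft]
  rw [hσ, recursion_mdl k ν a
    (fun i hi h => absurd (ha i (by omega) k (by omega) h) (by omega)) μ (by rw [hμN, hNs])]
  rw [← hN's]
  refine finsum_mem_congr rfl fun ρ hρ => ?_
  rw [hσ', hswap, sig_indep ν a b k (fun i hi j hj => ha i (by omega) j (by omega)) hb ρ
    (by rw [hρ.2.1, hN's])]
  rfl
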